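/- Let p be a prime and E ⊆ Z_p² nonempty. Then L²(E) has an orthogonal basis of characters (i.e. E is spectral: there exists B ⊆ Z_p² such that {x ↦ χ(x·b) : b ∈ B} is an orthogonal basis of L²(E)) if and only if E tiles Z_p² by translation (i.e. there exists A ⊆ Z_p² such that Σ_{a∈A} 1_E(x−a) = 1 for all x ∈ Z_p²). -/

import Mathlib

open Finset

/-- The fixed character `χ(t) = e^{2πi t/p}` of `ℤ/p`. -/
noncomputable def chi (p : ℕ) (t : ZMod p) : ℂ :=
  Complex.exp (2 * Real.pi * Complex.I * (t.val : ℂ) / (p : ℂ))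

/-- The dot product on `ℤ_p^d`. -/
def dotp {p d : ℕ} (x y : Fin d → ZMod p) : ZMod p := ∑ i, x i * y i

/-- The Gabor (time-frequency shifted) function `x ↦ g(x-a) χ(x·b)`. -/
noncomputable def gabor {p d : ℕ} (g : (Fin d → ZMod p) → ℂ) (a b : Fin d → ZMod p) :
    (Fin d → ZMod p) → ℂ :=
  fun x => g (x - a) * chi p (dotp x b)

/-- The inner product of `L²` with counting measure on a finite type. -/
noncomputable def innerC {V : Type*} [Fintype V] (f g : V → ℂ) : ℂ :=
  ∑ x, f x * (starRingEnd ℂ) (g x)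

/-- `𝒢(g, A, B)` is an orthonormal basis of `L²(ℤ_p^d)`: the family is orthonormal and
every function is a linear combination of its members. -/
def IsGaborONB {p d : ℕ} [NeZero p] (g : (Fin d → ZMod p) → ℂ)
    (A B : Finset (Fin d → ZMod p)) : Prop :=
  (∀ a ∈ A, ∀ b ∈ B, ∀ a' ∈ A, ∀ b' ∈ B,
    innerC (gabor g a b) (gabor g a' b') = if a = a' ∧ b = b' then 1 else 0)
  ∧ (∀ f : (Fin d → ZMod p) → ℂ, ∃ c : (Fin d → ZMod p) → (Fin d → ZMod p) → ℂ,
      f = fun x => ∑ a ∈ A, ∑ b ∈ B, c a b * gabor g a b x)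

/-- `(E, B)` is a spectral pair: the characters indexed by `B` are pairwise orthogonal in
`L²(E)` and span it. -/
def IsSpectralPair {p d : ℕ} [NeZero p] (E B : Finset (Fin d → ZMod p)) : Prop :=
  (∀ b ∈ B, ∀ b' ∈ B, b ≠ b' → ∑ x ∈ E, chi p (dotp x (b - b')) = 0)
  ∧ (∀ f : (Fin d → ZMod p) → ℂ, ∃ c : (Fin d → ZMod p) → ℂ,
      ∀ x ∈ E, f x = ∑ b ∈ B, c b * chi p (dotp x b))

/-- `(E, A)` is a tiling pair: `Σ_{a∈A} 1_E(x-a) = 1` for every `x`. -/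
def IsTilingPair {p d : ℕ} [NeZero p] (E A : Finset (Fin d → ZMod p)) : Prop :=
  ∀ x : Fin d → ZMod p, (∑ a ∈ A, if x - a ∈ E then (1 : ℕ) else 0) = 1

/-- The Fourier transform `ĝ(m) = p^{-d} Σ_x χ(-x·m) g(x)` on `ℤ_p^d`. -/
noncomputable def ft {p d : ℕ} [NeZero p] (g : (Fin d → ZMod p) → ℂ)
    (m : Fin d → ZMod p) : ℂ :=
  ((p : ℂ) ^ d)⁻¹ * ∑ x, chi p (-(dotp x m)) * g x

section ChiBasics

variable {p d : ℕ}

lemma chi_eq_stdAddChar [NeZero p] (t : ZMod p) : chi p t = ZMod.stdAddChar t := by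
  have h := ZMod.stdAddChar_coe (N := p) (t.val : ℤ)
  simp only [Int.cast_natCast, ZMod.natCast_zmod_val] at h
  exact h.symm

lemma chi_zero [NeZero p] : chi p 0 = 1 := by
  simp [chi_eq_stdAddChar]

lemma chi_add [NeZero p] (s t : ZMod p) : chi p (s + t) = chi p s * chi p t := by
  simp [chi_eq_stdAddChar, AddChar.map_add_eq_mul]

lemma dotp_eq_dotProduct (x y : Fin d → ZMod p) : dotp x y = x ⬝ᵥ y := rfl

lemma dotp_add_left (x y m : Fin d → ZMod p) : dotp (x + y) m = dotp x m + dotp y m := by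
  simp [dotp_eq_dotProduct]

lemma dotp_sub_left (x y m : Fin d → ZMod p) : dotp (x - y) m = dotp x m - dotp y m := by
  simp [dotp_eq_dotProduct]

lemma dotp_sub_right (x m n : Fin d → ZMod p) : dotp x (m - n) = dotp x m - dotp x n := by
  simp [dotp_eq_dotProduct]

lemma dotp_smul_right (c : ZMod p) (x m : Fin d → ZMod p) : dotp x (c • m) = c * dotp x m := by
  simp [dotp_eq_dotProduct]

lemma dotp_comm (x y : Fin d → ZMod p) : dotp x y = dotp y x :=
  dotProduct_comm x y

/-- Orthogonality of characters of `ℤ_p^d`. -/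
lemma sum_chi_dotp_eq_zero [Fact p.Prime] {m : Fin d → ZMod p} (hm : m ≠ 0) :
    ∑ x, chi p (dotp x m) = 0 := by
  obtain ⟨i, hi⟩ := Function.ne_iff.mp hm
  let ψ : AddChar (Fin d → ZMod p) ℂ :=
    { toFun := fun x => chi p (dotp x m)
      map_zero_eq_one' := by simp [dotp, chi_zero]
      map_add_eq_mul' := fun x y => by rw [dotp_add_left, chi_add] }
  refine AddChar.sum_eq_zero_iff_ne_zero (ψ := ψ) |>.mpr fun h => hi ?_
  have h1 : chi p (dotp (Pi.single i 1) m) = 1 := DFunLike.congr_fun h (Pi.single i 1)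
  rw [chi_eq_stdAddChar, ← (ZMod.stdAddChar (N := p)).map_zero_eq_one,
    ZMod.injective_stdAddChar.eq_iff] at h1
  simpa [dotp_eq_dotProduct] using h1

end ChiBasics

section Equidistribution

variable {p d : ℕ} [Fact p.Prime]

open Polynomial in
/-- The only rational linear relations between the `p`-th roots of unity are the multiples of
`∑ ζ ^ i = 0`. -/
lemma IsPrimitiveRoot.coeff_eq_of_sum_eq_zero {ζ : ℂ} (hζ : IsPrimitiveRoot ζ p) {a : ℕ → ℚ}
    (h : ∑ i ∈ range p, (a i : ℂ) * ζ ^ i = 0) {i : ℕ} (hi : i < p) : a i = a (p - 1) := by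
  have hp : p.Prime := Fact.out
  have hp1 : p - 1 + 1 = p := Nat.sub_add_cancel hp.one_le
  let P : ℚ[X] := ∑ i ∈ range (p - 1), C (a i - a (p - 1)) * X ^ i
  have hcoeff (j : ℕ) : P.coeff j = if j < p - 1 then a j - a (p - 1) else 0 := by
    simp only [P, finsetSum_coeff, coeff_C_mul, coeff_X_pow]
    simp
  have hgeom := hζ.geom_sum_eq_zero hp.one_lt
  have hroot : aeval ζ P = 0 := by
    have h2 : ∑ i ∈ range p, ((a i : ℂ) - a (p - 1)) * ζ ^ i = 0 := by
      simp only [sub_mul, sum_sub_distrib, ← mul_sum, h, hgeom, mul_zero, sub_zero]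
    rw [← hp1, sum_range_succ, hp1, sub_self, zero_mul, add_zero] at h2
    simpa [P] using h2
  have hP : P = 0 := by
    by_contra hne
    have hdeg := minpoly.degree_le_of_ne_zero ℚ ζ hne hroot
    rw [← cyclotomic_eq_minpoly_rat hζ hp.pos, degree_cyclotomic, Nat.totient_prime hp] at hdeg
    have hlt : P.degree < (p - 1 : ℕ) := by
      rw [degree_lt_iff_coeff_zero]
      intro j hj
      rw [hcoeff, if_neg (by omega)]
    exact absurd hdeg (not_le.mpr hlt)
  rcases Nat.lt_or_ge i (p - 1) with hlt | hge
  · have := hcoeff i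
    rw [hP, coeff_zero, if_pos hlt] at this
    linarith
  · rw [show i = p - 1 by omega]

lemma isPrimitiveRoot_chi_one : IsPrimitiveRoot (chi p 1) p := by
  have hp : p.Prime := Fact.out
  have : Fact (1 < p) := ⟨hp.one_lt⟩
  have h := Complex.isPrimitiveRoot_exp p hp.ne_zero
  simpa [chi, ZMod.val_one] using h

lemma chi_natCast (n : ℕ) : chi p (n : ZMod p) = chi p 1 ^ n := by
  rw [chi_eq_stdAddChar, chi_eq_stdAddChar, ← AddChar.map_nsmul_eq_pow, nsmul_one]

/-- A vanishing exponential sum forces equidistribution over the level sets of `x ↦ x·m`. -/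
lemma card_fiber_of_sum_chi_eq_zero {E : Finset (Fin d → ZMod p)} {m : Fin d → ZMod p}
    (h : ∑ x ∈ E, chi p (dotp x m) = 0) (t : ZMod p) :
    p * #{x ∈ E | dotp x m = t} = #E := by
  let a : ℕ → ℚ := fun i => #{x ∈ E | dotp x m = (i : ZMod p)}
  have hsum : ∑ i ∈ range p, (a i : ℂ) * chi p 1 ^ i = 0 := by
    have hmaps : ∀ x ∈ E, (dotp x m).val ∈ range p := fun x _ => mem_range.mpr (ZMod.val_lt _)
    rw [← h, ← sum_fiberwise_of_maps_to hmaps]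
    refine sum_congr rfl fun i hi => ?_
    have hfib : {x ∈ E | (dotp x m).val = i} = {x ∈ E | dotp x m = (i : ZMod p)} := by
      refine filter_congr fun x _ => ⟨fun hx => ?_, fun hx => ?_⟩
      · rw [← hx, ZMod.natCast_zmod_val]
      · rw [hx, ZMod.val_natCast_of_lt (mem_range.mp hi)]
    rw [hfib, sum_eq_card_nsmul fun x hx => by rw [(mem_filter.mp hx).2, chi_natCast]]
    simp [a]
  have hconst (s : ZMod p) :
      #{x ∈ E | dotp x m = s} = #{x ∈ E | dotp x m = ((p - 1 : ℕ) : ZMod p)} := by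
    have := isPrimitiveRoot_chi_one.coeff_eq_of_sum_eq_zero hsum s.val_lt
    simpa [a] using this
  rw [card_eq_sum_card_fiberwise (s := E) (f := fun x => dotp x m) (t := univ) (by simp),
    sum_congr rfl fun s _ => (hconst s).trans (hconst t).symm]
  simp

lemma sum_chi_smul_eq_zero {E : Finset (Fin d → ZMod p)} {m : Fin d → ZMod p}
    (h : ∑ x ∈ E, chi p (dotp x m) = 0) {c : ZMod p} (hc : c ≠ 0) :
    ∑ x ∈ E, chi p (dotp x (c • m)) = 0 := by
  have hp : p.Prime := Fact.out
  have hpC : (p : ℂ) ≠ 0 := by exact_mod_cast hp.ne_zero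
  have hfib (t : ZMod p) : (#{x ∈ E | dotp x m = t} : ℂ) = #E / p := by
    rw [eq_div_iff hpC, mul_comm]
    exact_mod_cast card_fiber_of_sum_chi_eq_zero h t
  have hgeom : ∑ t : ZMod p, chi p (c * t) = 0 := by
    simp_rw [chi_eq_stdAddChar, mul_comm c]
    rw [AddChar.sum_mulShift c (ZMod.isPrimitive_stdAddChar p), if_neg hc]
    simp
  rw [← sum_fiberwise E (fun x => dotp x m)]
  calc ∑ t, ∑ x ∈ E with dotp x m = t, chi p (dotp x (c • m))
      = ∑ t, (#E / p : ℂ) * chi p (c * t) := by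
        refine sum_congr rfl fun t _ => ?_
        rw [← hfib t, ← nsmul_eq_mul]
        refine sum_eq_card_nsmul fun x hx => ?_
        rw [dotp_smul_right, (mem_filter.mp hx).2]
    _ = 0 := by rw [← mul_sum, hgeom, mul_zero]

/-- A nonempty set whose indicator has Fourier transform supported at `0` is everything. -/
lemma card_of_forall_sum_chi_eq_zero {E : Finset (Fin d → ZMod p)} (hE : E.Nonempty)
    (h : ∀ m ≠ 0, ∑ x ∈ E, chi p (dotp x m) = 0) : #E = p ^ d := by
  obtain ⟨y, hy⟩ := hE
  have hinner (x : Fin d → ZMod p) :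
      ∑ m, chi p (dotp (x - y) m) = if x = y then (p : ℂ) ^ d else 0 := by
    split_ifs with hxy
    · simp [hxy, dotp, chi_zero]
    · simp_rw [dotp_comm (x - y)]
      exact sum_chi_dotp_eq_zero (sub_ne_zero.mpr hxy)
  have houter (m : Fin d → ZMod p) :
      ∑ x ∈ E, chi p (dotp (x - y) m) = if m = 0 then (#E : ℂ) else 0 := by
    split_ifs with hm
    · simp [hm, dotp, chi_zero]
    · simp_rw [dotp_sub_left, sub_eq_add_neg, chi_add, ← sum_mul, h m hm, zero_mul]
  have key : ∑ m, ∑ x ∈ E, chi p (dotp (x - y) m) = ∑ x ∈ E, ∑ m, chi p (dotp (x - y) m) :=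
    sum_comm
  simp_rw [hinner, houter] at key
  simp only [sum_ite_eq', mem_univ, if_true, hy] at key
  exact_mod_cast key

end Equidistribution

section SpectralPairs

variable {p d : ℕ}

lemma IsSpectralPair.card_le [NeZero p] {E B : Finset (Fin d → ZMod p)}
    (h : IsSpectralPair E B) : #E ≤ #B := by
  let v : B → (E → ℂ) := fun b x => chi p (dotp x.1 b.1)
  have htop : Submodule.span ℂ (Set.range v) = ⊤ := by
    refine Submodule.eq_top_iff'.mpr fun f => ?_
    obtain ⟨c, hc⟩ := h.2 fun x => if hx : x ∈ E then f ⟨x, hx⟩ else 0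
    have hf : f = ∑ b : B, c b • v b := by
      ext x
      have := hc x x.2
      rw [dif_pos x.2] at this
      simp only [Finset.sum_apply, Pi.smul_apply, smul_eq_mul, v]
      rw [this, ← sum_coe_sort B]
    rw [hf]
    exact Submodule.sum_mem _ fun b _ =>
      Submodule.smul_mem _ _ (Submodule.subset_span (Set.mem_range_self b))
  have hle := finrank_range_le_card (R := ℂ) v
  rw [Set.finrank, htop, finrank_top, Module.finrank_fintype_fun_eq_card] at hle
  simpa using hle

/-- Orthogonal characters, as many as there are points of `E`, span `L²(E)`. -/
lemma isSpectralPair_of_card_eq [NeZero p] {E B : Finset (Fin d → ZMod p)} (hE : E.Nonempty)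
    (hcard : #B = #E)
    (horth : ∀ b ∈ B, ∀ b' ∈ B, b ≠ b' → ∑ x ∈ E, chi p (dotp x (b - b')) = 0) :
    IsSpectralPair E B := by
  refine ⟨horth, fun f => ?_⟩
  have hE0 : (#E : ℂ) ≠ 0 := by exact_mod_cast hE.card_ne_zero
  let M : Matrix E B ℂ := fun x b => chi p (dotp x.1 b.1)
  let N : Matrix B E ℂ := fun b x => (#E : ℂ)⁻¹ * chi p (-dotp x.1 b.1)
  have hNM : N * M = 1 := by
    ext b b'
    have hentry : (N * M) b b' = (#E : ℂ)⁻¹ * ∑ x ∈ E, chi p (dotp x (b'.1 - b.1)) := by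
      rw [Matrix.mul_apply, ← sum_coe_sort E, mul_sum]
      refine sum_congr rfl fun x _ => ?_
      rw [dotp_sub_right, sub_eq_neg_add, chi_add, mul_assoc]
    rw [hentry, Matrix.one_apply]
    split_ifs with hbb
    · simp [hbb, dotp, chi_zero, hE0]
    · rw [horth _ b'.2 _ b.2 fun h => hbb (Subtype.ext h.symm), mul_zero]
  have hMN : M * N = 1 :=
    (Matrix.mul_eq_one_comm_of_card_eq _ _ _ (by simpa using hcard)).mp hNM
  let g : E → ℂ := fun x => f x
  refine ⟨fun b => if hb : b ∈ B then (N.mulVec g) ⟨b, hb⟩ else 0, fun x hx => ?_⟩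
  have hx' : (M.mulVec (N.mulVec g)) ⟨x, hx⟩ = f x := by
    rw [Matrix.mulVec_mulVec, hMN, Matrix.one_mulVec]
  rw [← hx', ← sum_coe_sort B]
  refine sum_congr rfl fun b _ => ?_
  simp [M, mul_comm]

end SpectralPairs

section Tilings

variable {p d : ℕ}

lemma IsTilingPair.sum_sum_add [NeZero p] {E A : Finset (Fin d → ZMod p)}
    (h : IsTilingPair E A) (g : (Fin d → ZMod p) → ℂ) :
    ∑ a ∈ A, ∑ e ∈ E, g (e + a) = ∑ x, g x := by
  have hx (x : Fin d → ZMod p) : g x = ∑ a ∈ A, if x - a ∈ E then g x else 0 := by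
    have := congrArg (fun n : ℕ => (n : ℂ) * g x) (h x)
    simpa only [Nat.cast_sum, Nat.cast_ite, Nat.cast_one, Nat.cast_zero, sum_mul, ite_mul,
      one_mul, zero_mul] using this.symm
  rw [Fintype.sum_congr _ _ hx, sum_comm (s := univ)]
  refine sum_congr rfl fun a _ => ?_
  rw [← Equiv.sum_comp (Equiv.addRight a)]
  simp

lemma IsTilingPair.card_mul_card [NeZero p] {E A : Finset (Fin d → ZMod p)}
    (h : IsTilingPair E A) : #A * #E = p ^ d := by
  have := h.sum_sum_add fun _ => 1
  simp only [sum_const, nsmul_eq_mul, mul_one, card_univ, Fintype.card_fun, ZMod.card,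
    Fintype.card_fin] at this
  exact_mod_cast this

lemma IsTilingPair.sum_chi_mul_sum_chi [Fact p.Prime] {E A : Finset (Fin d → ZMod p)}
    (h : IsTilingPair E A) {m : Fin d → ZMod p} (hm : m ≠ 0) :
    (∑ a ∈ A, chi p (dotp a m)) * ∑ e ∈ E, chi p (dotp e m) = 0 := by
  rw [← sum_chi_dotp_eq_zero hm, ← h.sum_sum_add, sum_mul_sum]
  simp_rw [dotp_add_left, chi_add, mul_comm]

lemma isTilingPair_of_existsUnique [NeZero p] {E A : Finset (Fin d → ZMod p)}
    (h : ∀ x, ∃! a, a ∈ A ∧ x - a ∈ E) : IsTilingPair E A := by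
  intro x
  obtain ⟨a, ⟨haA, haE⟩, huniq⟩ := h x
  rw [sum_eq_single_of_mem a haA, if_pos haE]
  intro b hb hne
  exact if_neg fun hbE => hne (huniq b ⟨hb, hbE⟩)

/-- A set meeting every level line of `x ↦ x·m` exactly once is a graph over the quotient by
one of these lines, hence tiles with it. -/
lemma isTilingPair_filter_dotp_eq_zero [Fact p.Prime] {E : Finset (Fin d → ZMod p)}
    {m : Fin d → ZMod p} (h : ∀ t, #{x ∈ E | dotp x m = t} = 1) :
    IsTilingPair E {a | dotp a m = 0} := by
  refine isTilingPair_of_existsUnique fun x => ?_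
  obtain ⟨e, he⟩ := card_eq_one.mp (h (dotp x m))
  have hmem (y : Fin d → ZMod p) : y ∈ E ∧ dotp y m = dotp x m ↔ y = e := by
    rw [← mem_singleton (a := e), ← he, mem_filter]
  have hee := (hmem e).mpr rfl
  refine ⟨x - e, ⟨by simp [dotp_sub_left, hee.2], by simpa using hee.1⟩, ?_⟩
  rintro a ⟨ha, haE⟩
  have hax := (hmem (x - a)).mp ⟨haE, by simp [dotp_sub_left, (mem_filter.mp ha).2]⟩
  rw [← hax, sub_sub_cancel]

end Tilings

section Plane

variable {p : ℕ} [Fact p.Prime]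

/-- A set of more than `p` points in the plane determines every direction. -/
lemma exists_sub_eq_smul_of_lt_card {B : Finset (Fin 2 → ZMod p)} (hB : p < #B)
    {m : Fin 2 → ZMod p} (hm : m ≠ 0) :
    ∃ b ∈ B, ∃ b' ∈ B, b ≠ b' ∧ ∃ c : ZMod p, c ≠ 0 ∧ m = c • (b - b') := by
  obtain ⟨b, hb, b', hb', hne, heq⟩ := exists_ne_map_eq_of_card_lt_of_maps_to
    (t := (univ : Finset (ZMod p))) (by simpa [ZMod.card] using hB)
    (f := fun b : Fin 2 → ZMod p => m 0 * b 1 - m 1 * b 0) (fun _ _ => mem_coe.mpr (mem_univ _))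
  refine ⟨b, hb, b', hb', hne, ?_⟩
  have hcross : m 0 * (b 1 - b' 1) = m 1 * (b 0 - b' 0) := by linear_combination heq
  have hex : ∃ c : ZMod p, m = c • (b - b') := by
    by_cases h0 : b 0 - b' 0 = 0
    · have h1 : b 1 - b' 1 ≠ 0 := fun h1 => hne <| by
        ext i; fin_cases i
        · exact sub_eq_zero.mp h0
        · exact sub_eq_zero.mp h1
      have hm0 : m 0 = 0 := by
        rw [h0, mul_zero] at hcross
        exact (mul_eq_zero.mp hcross).resolve_right h1
      refine ⟨m 1 / (b 1 - b' 1), ?_⟩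
      ext i; fin_cases i
      · simp [h0, hm0]
      · simp [div_mul_cancel₀ _ h1]
    · refine ⟨m 0 / (b 0 - b' 0), ?_⟩
      ext i; fin_cases i
      · simp [div_mul_cancel₀ _ h0]
      · simp only [Fin.mk_one, Pi.smul_apply, Pi.sub_apply, smul_eq_mul]
        field_simp
        linear_combination -hcross
  obtain ⟨c, hc⟩ := hex
  exact ⟨c, fun h0 => hm (by rw [hc, h0, zero_smul]), hc⟩

lemma IsSpectralPair.exists_isTilingPair {E B : Finset (Fin 2 → ZMod p)} (hE : E.Nonempty)
    (h : IsSpectralPair E B) : ∃ A : Finset (Fin 2 → ZMod p), IsTilingPair E A := by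
  have hp : p.Prime := Fact.out
  have hle := h.card_le
  rcases Nat.lt_or_ge 1 #E with h1 | h1
  · obtain ⟨b, hb, b', hb', hne⟩ := one_lt_card.mp (h1.trans_le hle)
    have hfib := card_fiber_of_sum_chi_eq_zero (h.1 b hb b' hb' hne)
    rcases Nat.lt_or_ge p #E with hlt | hge
    · have hvanish (m : Fin 2 → ZMod p) (hm : m ≠ 0) : ∑ x ∈ E, chi p (dotp x m) = 0 := by
        obtain ⟨b, hb, b', hb', hne, c, hc, rfl⟩ :=
          exists_sub_eq_smul_of_lt_card (hlt.trans_le hle) hm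
        exact sum_chi_smul_eq_zero (h.1 b hb b' hb' hne) hc
      have huniv : E = univ := by
        rw [← card_eq_iff_eq_univ, card_of_forall_sum_chi_eq_zero hE hvanish]
        simp
      exact ⟨{0}, by simp [IsTilingPair, huniv]⟩
    · refine ⟨_, isTilingPair_filter_dotp_eq_zero (m := b - b') fun t => ?_⟩
      have ht := hfib t
      have hle1 : #{x ∈ E | dotp x (b - b') = t} ≤ 1 :=
        Nat.le_of_mul_le_mul_left (by omega) hp.pos
      refine le_antisymm hle1 (Nat.one_le_iff_ne_zero.mpr fun h0 => ?_)
      rw [h0, mul_zero] at ht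
      omega
  · obtain ⟨e, rfl⟩ := card_eq_one.mp (le_antisymm h1 hE.card_pos)
    refine ⟨univ, isTilingPair_of_existsUnique fun x => ⟨x - e, by simp, ?_⟩⟩
    rintro a ⟨-, ha⟩
    rw [← mem_singleton.mp ha, sub_sub_cancel]

lemma IsTilingPair.exists_isSpectralPair {E A : Finset (Fin 2 → ZMod p)} (hE : E.Nonempty)
    (h : IsTilingPair E A) : ∃ B : Finset (Fin 2 → ZMod p), IsSpectralPair E B := by
  have hp : p.Prime := Fact.out
  have hcard := h.card_mul_card
  obtain ⟨k, hk, hEk⟩ := (Nat.dvd_prime_pow hp).mp (Dvd.intro_left _ hcard)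
  interval_cases k
  · exact ⟨{0}, isSpectralPair_of_card_eq hE (by simp [hEk]) (by simp)⟩
  · rw [pow_one] at hEk
    have hA : #A = p := by
      rw [hEk, pow_two] at hcard
      exact Nat.eq_of_mul_eq_mul_right hp.pos hcard
    have hAne : A.Nonempty := card_pos.mp (by rw [hA]; exact hp.pos)
    obtain ⟨m, hm, hmE⟩ : ∃ m ≠ 0, ∑ x ∈ E, chi p (dotp x m) = 0 := by
      by_contra! hno
      have hAcard := card_of_forall_sum_chi_eq_zero hAne fun m hm =>
        (mul_eq_zero.mp (h.sum_chi_mul_sum_chi hm)).resolve_right (hno m hm)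
      rw [hA] at hAcard
      exact absurd hAcard (lt_self_pow₀ hp.one_lt one_lt_two).ne
    refine ⟨univ.image fun c : ZMod p => c • m, isSpectralPair_of_card_eq hE ?_ ?_⟩
    · rw [card_image_of_injective _ (smul_left_injective _ hm), card_univ, ZMod.card, hEk]
    · simp only [mem_image, mem_univ, true_and, forall_exists_index, forall_apply_eq_imp_iff]
      intro s t hst
      rw [← sub_smul]
      exact sum_chi_smul_eq_zero hmE (sub_ne_zero.mpr fun h => hst (by rw [h]))
  · have huniv : E = univ := by
      rw [← card_eq_iff_eq_univ, hEk]
      simp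
    refine ⟨univ, isSpectralPair_of_card_eq hE (by rw [huniv]) fun b _ b' _ hne => ?_⟩
    rw [huniv]
    exact sum_chi_dotp_eq_zero (sub_ne_zero.mpr hne)

end Plane

/-- **Fuglede conjecture in `ℤ_p²`.** A nonempty set `E ⊆ ℤ_p²` is
spectral iff it tiles `ℤ_p²` by translation. -/
theorem spectral_iff_tiles_zmod_p_sq
    (p : ℕ) [Fact p.Prime] (E : Finset (Fin 2 → ZMod p)) (hE : E.Nonempty) :
    (∃ B : Finset (Fin 2 → ZMod p), IsSpectralPair E B) ↔
      (∃ A : Finset (Fin 2 → ZMod p), IsTilingPair E A) :=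
  ⟨fun ⟨_, h⟩ => h.exists_isTilingPair hE, fun ⟨_, h⟩ => h.exists_isSpectralPair hE⟩
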